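/- arXiv:1504.02031 — 7 statements merged into one kernel-verified Lean document; each statement's English description precedes it below -/
import Mathlib

section
/- Let k_i, k_j, k'_i, k'_j be nonnegative real numbers such that k_i ≤ k_j and k'_i ≥ k'_j. Then min{k_i, k'_i} + min{k_j, k'_j} ≤ min{k_i, k'_j} + min{k_j, k'_i}. -/
/-- Lemma 4 (rearra): transposition inequality for sums of pairwise minima. -/
theorem min_transposition_ineq (ki kj ki' kj' : ℝ)
    (hki : 0 ≤ ki) (hkj : 0 ≤ kj) (hki' : 0 ≤ ki') (hkj' : 0 ≤ kj')
    (h : ki ≤ kj) (h' : kj' ≤ ki') :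
    min ki ki' + min kj kj' ≤ min ki kj' + min kj ki' := by
  simp only [min_def]
  split_ifs <;> linarith
end

section
/- Let G and G' be two simple graphs on the same vertex set of cardinality N, with edge sets E and E', and let S = ∑_{v} min{deg_G(v), deg_{G'}(v)}. Then |E ∩ E'| · (2(|E| + |E'|) − S) ≤ (|E| + |E'| − |E ∩ E'|) · S. Equivalently, writing M = S/2, the overlap satisfies Ov(G,G') = |E ∩ E'|/|E ∪ E'| ≤ M / (|E| + |E'| − M). -/
open Finset

theorem two_mul_inter_le_aux (V : Type*) [Fintype V] [DecidableEq V]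
    (G G' : SimpleGraph V) [DecidableRel G.Adj] [DecidableRel G'.Adj] :
    2 * (G.edgeFinset ∩ G'.edgeFinset).card ≤ ∑ v : V, min (G.degree v) (G'.degree v) := by
  classical
  have e : (G.edgeFinset ∩ G'.edgeFinset).card = (G ⊓ G').edgeFinset.card := by
    congr 1
    ext x
    induction x with
    | _ x y => simp
  have t := SimpleGraph.sum_degrees_eq_twice_card_edges (G ⊓ G')
  have e2 : 2 * (G.edgeFinset ∩ G'.edgeFinset).card = ∑ v, (G ⊓ G').degree v := by
    rw [t, e]
    congr!
  rw [e2]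
  apply Finset.sum_le_sum
  intro v _
  exact le_min (SimpleGraph.degree_le_of_le inf_le_left)
    (SimpleGraph.degree_le_of_le inf_le_right)

/-- Graph-level form of Theorem 5 (Lpp): with S = ∑_v min{deg_G v, deg_{G'} v},
the number of common links satisfies
|E ∩ E'|·(2(|E|+|E'|) − S) ≤ (|E|+|E'| − |E ∩ E'|)·S; equivalently, with M = S/2,
the overlap Ov(G,G') = |E ∩ E'|/|E ∪ E'| is at most M/(|E|+|E'| − M). -/
theorem overlap_le_Lpp (V : Type*) [Fintype V] [DecidableEq V] (N : ℕ)
    (hN : Fintype.card V = N)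
    (G G' : SimpleGraph V) [DecidableRel G.Adj] [DecidableRel G'.Adj] :
    (((G.edgeFinset ∩ G'.edgeFinset).card : ℤ) *
        (2 * ((G.edgeFinset.card : ℤ) + G'.edgeFinset.card) -
          ∑ v : V, (min (G.degree v) (G'.degree v) : ℤ)) ≤
      ((G.edgeFinset.card : ℤ) + G'.edgeFinset.card - (G.edgeFinset ∩ G'.edgeFinset).card) *
        ∑ v : V, (min (G.degree v) (G'.degree v) : ℤ)) ∧
    (((G.edgeFinset ∩ G'.edgeFinset).card : ℝ) / (G.edgeFinset ∪ G'.edgeFinset).card ≤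
      ((∑ v : V, (min (G.degree v) (G'.degree v) : ℝ)) / 2) /
        ((G.edgeFinset.card : ℝ) + G'.edgeFinset.card -
          (∑ v : V, (min (G.degree v) (G'.degree v) : ℝ)) / 2)) := by
  have h0 := two_mul_inter_le_aux V G G'
  have h1 : ∑ v : V, min (G.degree v) (G'.degree v) ≤ 2 * G.edgeFinset.card := by
    rw [← SimpleGraph.sum_degrees_eq_twice_card_edges]
    exact Finset.sum_le_sum fun v _ => min_le_left _ _
  have h2 : ∑ v : V, min (G.degree v) (G'.degree v) ≤ 2 * G'.edgeFinset.card := by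
    rw [← SimpleGraph.sum_degrees_eq_twice_card_edges]
    exact Finset.sum_le_sum fun v _ => min_le_right _ _
  have h3 := Finset.card_union_add_card_inter G.edgeFinset G'.edgeFinset
  have eZ : ∑ v : V, (min (G.degree v) (G'.degree v) : ℤ)
      = ((∑ v : V, min (G.degree v) (G'.degree v) : ℕ) : ℤ) := by push_cast; rfl
  have eR : ∑ v : V, (min (G.degree v) (G'.degree v) : ℝ)
      = ((∑ v : V, min (G.degree v) (G'.degree v) : ℕ) : ℝ) := by push_cast; rfl
  rw [eZ, eR]
  generalize (∑ v : V, min (G.degree v) (G'.degree v)) = S at *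
  generalize (G.edgeFinset ∩ G'.edgeFinset).card = x at *
  generalize (G.edgeFinset ∪ G'.edgeFinset).card = u at *
  generalize G.edgeFinset.card = a at *
  generalize G'.edgeFinset.card = b at *
  constructor
  · zify at h0
    have ha : (0 : ℤ) ≤ (a : ℤ) + b := by positivity
    nlinarith [mul_le_mul_of_nonneg_left h0 ha]
  · have k0 : (2 : ℝ) * x ≤ S := by exact_mod_cast h0
    have k1 : (S : ℝ) ≤ 2 * a := by exact_mod_cast h1
    have k2 : (S : ℝ) ≤ 2 * b := by exact_mod_cast h2
    have k3 : (u : ℝ) + x = a + b := by exact_mod_cast h3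
    have ka : (0 : ℝ) ≤ a := by positivity
    have kb : (0 : ℝ) ≤ b := by positivity
    have kS : (0 : ℝ) ≤ S := by positivity
    rcases Nat.eq_zero_or_pos u with hu | hu
    · subst hu
      simp only [Nat.cast_zero, div_zero]
      apply div_nonneg <;> linarith
    · have ku : (0 : ℝ) < u := by exact_mod_cast hu
      have kd : (0 : ℝ) < a + b - S / 2 := by
        rcases lt_or_ge (0 : ℝ) ((a : ℝ) + b - S / 2) with h | h
        · exact h
        · have kx : (0 : ℝ) ≤ x := by positivity
          linarith
      rw [div_le_div_iff₀ ku kd]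
      have hab : (0 : ℝ) ≤ (a : ℝ) + b := by positivity
      have hu' : (u : ℝ) = a + b - x := by linarith
      rw [hu']
      nlinarith [mul_le_mul_of_nonneg_left k0 hab]
end

section
/- Let G and G' be two simple graphs on the same vertex set of cardinality N with edge sets E and E', and suppose E ∪ E' is nonempty. Let d : Fin N → ℕ and d' : Fin N → ℕ be monotone nondecreasing enumerations of the degree sequences of G and G' respectively (i.e., there exist bijections e, e' from Fin N to the vertex set with d(i) = deg_G(e(i)) and d'(i) = deg_{G'}(e'(i)) for all i, and d, d' monotone). Then |E ∩ E'| · ∑_{i} max{d(i), d'(i)} ≤ |E ∪ E'| · ∑_{i} min{d(i), d'(i)}; that is, the overlap satisfies Ov(G,G') ≤ (∑_i min{d(i), d'(i)}) / (∑_i max{d(i), d'(i)}). -/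
open Finset

lemma min_eq_level (K x y : ℕ) (hx : x ≤ K) :
    min x y = ∑ t ∈ range K, (if t < x then 1 else 0) * (if t < y then 1 else 0) := by
  have h : ∀ t, (if t < x then 1 else 0) * (if t < y then 1 else 0) = if t < min x y then 1 else 0 := by
    intro t
    by_cases h1 : t < x <;> by_cases h2 : t < y <;> simp [h1, h2]
  simp only [h]
  rw [← Finset.sum_filter, Finset.sum_const, smul_eq_mul, mul_one]
  have : (range K).filter (fun t => t < min x y) = range (min x y) := by
    ext t; simp only [mem_filter, mem_range]; omega
  rw [this, card_range]

lemma sum_min_perm_le {N : ℕ} (d d' : Fin N → ℕ) (hd : Monotone d) (hd' : Monotone d')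
    (σ : Equiv.Perm (Fin N)) :
    ∑ i, min (d i) (d' (σ i)) ≤ ∑ i, min (d i) (d' i) := by
  have hK : ∀ i, d i ≤ ∑ j, d j := fun i =>
    Finset.single_le_sum (f := d) (fun _ _ => Nat.zero_le _) (mem_univ i)
  rw [Finset.sum_congr rfl (fun i _ => min_eq_level _ (d i) (d' (σ i)) (hK i)),
    Finset.sum_congr rfl (fun i _ => min_eq_level _ (d i) (d' i) (hK i)),
    Finset.sum_comm, Finset.sum_comm (s := univ)]
  refine Finset.sum_le_sum fun t _ => ?_
  have key : ∀ c : Fin N → ℕ, Monotone c → Monotone (fun i => if t < c i then 1 else 0 : Fin N → ℕ) := by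
    intro c hc i j hij
    have := hc hij
    dsimp only
    split_ifs <;> omega
  exact ((key d hd).monovary (key d' hd')).sum_mul_comp_perm_le_sum_mul (σ := σ)

/-- Theorem 6 (ordenades): if d and d' are the increasingly sorted degree sequences
of two graphs G, G' on the same vertex set of cardinality N, then the overlap
Ov(G,G') = |E ∩ E'|/|E ∪ E'| is at most (∑ min{d i, d' i})/(∑ max{d i, d' i}),
stated in cross-multiplied form. -/
theorem overlap_le_sorted_min_div_max (V : Type*) [Fintype V] [DecidableEq V]
    (N : ℕ) (hN : Fintype.card V = N)
    (G G' : SimpleGraph V) [DecidableRel G.Adj] [DecidableRel G'.Adj]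
    (hne : (G.edgeFinset ∪ G'.edgeFinset).Nonempty)
    (d d' : Fin N → ℕ) (hd : Monotone d) (hd' : Monotone d')
    (e e' : Fin N ≃ V)
    (hde : ∀ i, d i = G.degree (e i)) (hde' : ∀ i, d' i = G'.degree (e' i)) :
    (G.edgeFinset ∩ G'.edgeFinset).card * ∑ i, max (d i) (d' i) ≤
      (G.edgeFinset ∪ G'.edgeFinset).card * ∑ i, min (d i) (d' i) := by
  have h1 : ∑ i, d i = 2 * G.edgeFinset.card := by
    rw [← G.sum_degrees_eq_twice_card_edges, ← Equiv.sum_comp e]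
    exact Finset.sum_congr rfl fun i _ => hde i
  have h2 : ∑ i, d' i = 2 * G'.edgeFinset.card := by
    rw [← G'.sum_degrees_eq_twice_card_edges, ← Equiv.sum_comp e']
    exact Finset.sum_congr rfl fun i _ => hde' i
  have h3 : ∑ i, min (d i) (d' i) + ∑ i, max (d i) (d' i) = ∑ i, d i + ∑ i, d' i := by
    rw [← Finset.sum_add_distrib, ← Finset.sum_add_distrib]
    exact Finset.sum_congr rfl fun i _ => min_add_max _ _
  have h4 := Finset.card_union_add_card_inter G.edgeFinset G'.edgeFinset
  have h5 : 2 * (G.edgeFinset ∩ G'.edgeFinset).card ≤ ∑ i, min (d i) (d' i) := by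
    have hi : G.edgeFinset ∩ G'.edgeFinset = (G ⊓ G').edgeFinset := by
      ext x
      simp only [mem_inter, SimpleGraph.mem_edgeFinset, SimpleGraph.edgeSet_inf, Set.mem_inter_iff]
    have hs : ∑ v, (G ⊓ G').degree v = 2 * (G.edgeFinset ∩ G'.edgeFinset).card := by
      rw [hi]
      convert (G ⊓ G').sum_degrees_eq_twice_card_edges
    rw [← hs, ← Equiv.sum_comp e]
    refine le_trans (Finset.sum_le_sum fun i _ => ?_)
      (sum_min_perm_le d d' hd hd' (e.trans e'.symm))
    have hv : ∀ v w, v = w → G'.degree v = G'.degree w := by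
      rintro v _ rfl
      rfl
    rw [hde, hde', hv _ (e i) (by simp)]
    exact le_min (SimpleGraph.degree_le_of_le inf_le_left)
      (SimpleGraph.degree_le_of_le inf_le_right)
  rw [h1, h2] at h3
  generalize (G.edgeFinset ∩ G'.edgeFinset).card = a at *
  generalize (G.edgeFinset ∪ G'.edgeFinset).card = u at *
  generalize ∑ i, min (d i) (d' i) = m at *
  generalize ∑ i, max (d i) (d' i) = M at *
  have h6 : m + M = 2 * u + 2 * a := by omega
  have h7 : M ≤ 2 * u := by omega
  nlinarith [Nat.mul_le_mul_right M h5, Nat.mul_le_mul_left m h7]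
end

section
/- Let E, E', E₂, E₂' be finite sets with |E₂| = |E|, |E₂'| = |E'|, and |E₂ ∩ E₂'| = |E ∩ E'| + x for some x ∈ {1, 2}, and suppose E₂ ∪ E₂' is nonempty. Set L = |E| + |E'| and let O = |E ∩ E'| / |E ∪ E'| be the Jaccard overlap of E and E' (as a real number). Then the Jaccard overlap of E₂ and E₂' equals O + (x·O² + 2x·O + x) / (L − x − x·O); in particular it is strictly larger than O. -/
open Finset

/-- Equation (6) (mesov): if the numbers of links of each layer are unchanged and
the number of common links increases by x ∈ {1,2}, then the Jaccard overlap
increases exactly by (x·O² + 2x·O + x)/(L − x − x·O); in particular it strictly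
increases. -/
theorem overlap_after_rewiring {α : Type*} [DecidableEq α]
    (E E' E₂ E₂' : Finset α) (x : ℕ) (hx : x = 1 ∨ x = 2)
    (hcard : E₂.card = E.card) (hcard' : E₂'.card = E'.card)
    (hint : (E₂ ∩ E₂').card = (E ∩ E').card + x)
    (hne : (E₂ ∪ E₂').Nonempty) :
    ((E₂ ∩ E₂').card : ℝ) / (E₂ ∪ E₂').card =
      ((E ∩ E').card : ℝ) / (E ∪ E').card +
        ((x : ℝ) * (((E ∩ E').card : ℝ) / (E ∪ E').card) ^ 2 +
          2 * x * (((E ∩ E').card : ℝ) / (E ∪ E').card) + x) /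
          (((E.card : ℝ) + E'.card) - x - x * (((E ∩ E').card : ℝ) / (E ∪ E').card)) ∧
    ((E ∩ E').card : ℝ) / (E ∪ E').card < ((E₂ ∩ E₂').card : ℝ) / (E₂ ∪ E₂').card := by
  have h1 := Finset.card_union_add_card_inter E E'
  have h2 := Finset.card_union_add_card_inter E₂ E₂'
  have hv := hne.card_pos
  have hx0 : 0 < x := by omega
  have hu : (E ∪ E').card = (E₂ ∪ E₂').card + x := by omega
  have hL : (E.card : ℝ) + E'.card = (E₂ ∪ E₂').card + x + (E ∩ E').card := by
    rw [hu] at h1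
    exact_mod_cast h1.symm
  rw [hL, hu, hint]
  push_cast
  generalize (E₂ ∪ E₂').card = v at *
  generalize (E ∩ E').card = c at *
  have hvR : (0 : ℝ) < v := by exact_mod_cast hv
  have hxR : (0 : ℝ) < x := by exact_mod_cast hx0
  have hcR : (0 : ℝ) ≤ c := Nat.cast_nonneg c
  generalize (v : ℝ) = v at *
  generalize (c : ℝ) = c at *
  generalize (x : ℝ) = x at *
  have hD : (v + x + c) - x - x * (c / (v + x)) = (v + x + c) * v / (v + x) := by
    field_simp
    ring
  constructor
  · rw [hD]
    field_simp
    ring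
  · rw [div_lt_div_iff₀ (by positivity) hvR]
    nlinarith [mul_pos hxR hvR, mul_nonneg hcR hxR.le, mul_pos hxR hxR]
end

section
/- Let G and G' be simple graphs on the same finite vertex set, and let {a,b}, {c,d} be a good pair in G with respect to G', i.e., a, b, c, d are pairwise distinct, {a,b} and {c,d} are edges of G but not of G', {a,c} and {b,d} are not edges of G, and {a,c} is an edge of G'. Let G₂ be obtained from G by deleting the edges {a,b}, {c,d} and adding the edges {a,c}, {b,d}. Then |E(G₂) ∩ E(G')| = |E(G) ∩ E(G')| + 2 if {b,d} is an edge of G', and |E(G₂) ∩ E(G')| = |E(G) ∩ E(G')| + 1 otherwise. -/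
open Finset

/-- Counting claim of Section 5 underlying equation (6): cross-rewiring a good pair
{a,b}, {c,d} of G with respect to G' (i.e. a,b,c,d pairwise distinct, {a,b},{c,d}
edges of G but not of G', {a,c},{b,d} not edges of G, and {a,c} an edge of G')
increases the number of common links by exactly 2 if {b,d} is an edge of G',
and by exactly 1 otherwise. -/
theorem cross_rewiring_common_links (V : Type*) [Fintype V] [DecidableEq V]
    (G G' G₂ : SimpleGraph V)
    [DecidableRel G.Adj] [DecidableRel G'.Adj] [DecidableRel G₂.Adj]
    (a b c d : V)
    (hab : a ≠ b) (hac : a ≠ c) (had : a ≠ d) (hbc : b ≠ c) (hbd : b ≠ d) (hcd : c ≠ d)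
    (hGab : G.Adj a b) (hGcd : G.Adj c d)
    (hG'ab : ¬ G'.Adj a b) (hG'cd : ¬ G'.Adj c d)
    (hGac : ¬ G.Adj a c) (hGbd : ¬ G.Adj b d)
    (hG'ac : G'.Adj a c)
    (hG₂ : G₂ = (G.deleteEdges {s(a, b), s(c, d)}) ⊔
      SimpleGraph.fromEdgeSet {s(a, c), s(b, d)}) :
    (G'.Adj b d →
      (G₂.edgeFinset ∩ G'.edgeFinset).card = (G.edgeFinset ∩ G'.edgeFinset).card + 2) ∧
    (¬ G'.Adj b d →
      (G₂.edgeFinset ∩ G'.edgeFinset).card = (G.edgeFinset ∩ G'.edgeFinset).card + 1) := by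
  have hne : s(a, c) ≠ s(b, d) := by
    intro h
    rcases Sym2.eq_iff.1 h with ⟨h1, _⟩ | ⟨h1, _⟩
    · exact hab h1
    · exact had h1
  have hmem : ∀ e : Sym2 V, e ∈ G₂.edgeSet ↔
      (e ∈ G.edgeSet ∧ ¬ (e = s(a, b) ∨ e = s(c, d))) ∨ (e = s(a, c) ∨ e = s(b, d)) := by
    intro e
    have h1 : ¬ (s(a, c)).IsDiag := by simpa using hac
    have h2 : ¬ (s(b, d)).IsDiag := by simpa using hbd
    rw [hG₂, SimpleGraph.edgeSet_sup, SimpleGraph.edgeSet_deleteEdges,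
      SimpleGraph.edgeSet_fromEdgeSet]
    simp only [Set.mem_union, Set.mem_diff, Set.mem_insert_iff, Set.mem_singleton_iff]
    constructor
    · rintro (h | h)
      · exact Or.inl h
      · exact Or.inr h.1
    · rintro (h | h)
      · exact Or.inl h
      · refine Or.inr ⟨h, ?_⟩
        rcases h with rfl | rfl
        · simpa using hac
        · simpa using hbd
  rw [← SimpleGraph.mem_edgeSet] at hG'ab hG'cd hGac hGbd hG'ac
  constructor
  · intro h
    rw [← SimpleGraph.mem_edgeSet] at h
    have key : G₂.edgeFinset ∩ G'.edgeFinset =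
        insert s(a, c) (insert s(b, d) (G.edgeFinset ∩ G'.edgeFinset)) := by
      ext e
      simp only [Finset.mem_inter, Finset.mem_insert, SimpleGraph.mem_edgeFinset, hmem]
      grind
    rw [key, Finset.card_insert_of_notMem, Finset.card_insert_of_notMem]
    · simp only [Finset.mem_inter, SimpleGraph.mem_edgeFinset]; tauto
    · simp only [Finset.mem_inter, Finset.mem_insert, SimpleGraph.mem_edgeFinset]; tauto
  · intro h
    rw [← SimpleGraph.mem_edgeSet] at h
    have key : G₂.edgeFinset ∩ G'.edgeFinset =
        insert s(a, c) (G.edgeFinset ∩ G'.edgeFinset) := by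
      ext e
      simp only [Finset.mem_inter, Finset.mem_insert, SimpleGraph.mem_edgeFinset, hmem]
      grind
    rw [key, Finset.card_insert_of_notMem]
    simp only [Finset.mem_inter, SimpleGraph.mem_edgeFinset]; tauto
end

section
/- Let β, β_c, r, μ, c be real numbers with r > 0, μ > 0, c > 0 and β_c < β. Then the function R₀(α) = (c/((1+α)·μ)) · (β·(1 − r·α) + β_c·(1 + r)·α) is strictly decreasing in α on [0, ∞); that is, the basic reproduction number is a strictly decreasing function of the overlap coefficient between the two layers as long as β_c < β. -/
/-- The basic reproduction number R₀(α) of the mean-field SIS model with awareness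
is a strictly decreasing function of the overlap coefficient α on [0,∞) when β_c < β. -/
theorem R0_strictAnti (β βc r μ c : ℝ) (hr : 0 < r) (hμ : 0 < μ) (hc : 0 < c)
    (hβ : βc < β) :
    StrictAntiOn
      (fun α : ℝ => (c / ((1 + α) * μ)) * (β * (1 - r * α) + βc * (1 + r) * α))
      (Set.Ici (0 : ℝ)) := by
  intro a ha b hb hab
  have ha' : 0 < 1 + a := by have := Set.mem_Ici.mp ha; linarith
  have hb' : 0 < 1 + b := by have := Set.mem_Ici.mp hb; linarith
  have h1 : 0 < β - βc := sub_pos.mpr hβ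
  have h2 : 0 < b - a := sub_pos.mpr hab
  have key : (c / ((1 + a) * μ)) * (β * (1 - r * a) + βc * (1 + r) * a)
      - (c / ((1 + b) * μ)) * (β * (1 - r * b) + βc * (1 + r) * b)
      = c * ((β - βc) * (1 + r) * (b - a)) / (μ * ((1 + a) * (1 + b))) := by
    field_simp
    ring
  have hpos : 0 < c * ((β - βc) * (1 + r) * (b - a)) / (μ * ((1 + a) * (1 + b))) := by
    positivity
  rw [← key] at hpos
  exact sub_pos.mp hpos
end

section
/- Let N ≥ 2 and let k : Fin N → ℕ be a degree sequence with ∑_v k(v) = 2L for some positive integer L. Fix two distinct indices i, j with 1 ≤ k(i) ≤ k(j). Consider the set S of all functions Y : Fin (2L) → Fin N such that the fiber Y⁻¹(v) has cardinality k(v) for every v (the rearrangements of the stub vector), so that |S| = (2L)! / ∏_v k(v)!. Let A ⊆ S be the subset of those Y for which there exists l with 0 ≤ l < L such that (Y(2l) = i and Y(2l+1) = j) or (Y(2l) = j and Y(2l+1) = i). Then, as an identity of rational numbers, |A| / |S| = (L!·k(i)!·k(j)!/(2L)!) · ∑_{l=1}^{k(i)} (−1)^{l−1} · 2^l · (2L−2l)!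 / (l!·(L−l)!·(k(i)−l)!·(k(j)−l)!). -/
open Finset

open MvPolynomial in
lemma cm_coeff {N : ℕ} (n : ℕ) (m : Fin N →₀ ℕ) (h : ∑ v, m v = n) :
    coeff m ((∑ v, X v : MvPolynomial (Fin N) ℚ) ^ n) = (n.factorial : ℚ) / ∏ v, ((m v).factorial : ℚ) := by
  rw [Finset.sum_pow_eq_sum_piAntidiag, coeff_sum, Finset.sum_eq_single (m : Fin N → ℕ)]
  · have h1 : (∏ v, (X v : MvPolynomial (Fin N) ℚ) ^ (m v)) = monomial m 1 := by
      rw [monomial_eq, Finsupp.prod_fintype _ _ (by simp)]; simp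
    rw [h1, ← map_natCast (C : ℚ →+* MvPolynomial (Fin N) ℚ), coeff_C_mul, coeff_monomial]
    have := Nat.multinomial_spec univ (m : Fin N → ℕ)
    rw [h] at this
    rw [← this]
    push_cast
    have h0 : (∏ v, ((m v).factorial : ℚ)) ≠ 0 := by
      apply Finset.prod_ne_zero_iff.2; intro v _; positivity
    simp
    field_simp
  · intro b _ hb
    have h1 : (∏ v, (X v : MvPolynomial (Fin N) ℚ) ^ (b v)) = monomial (Finsupp.equivFunOnFinite.symm b) 1 := by
      rw [monomial_eq, Finsupp.prod_fintype _ _ (by simp)]; simp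
    rw [h1, ← map_natCast (C : ℚ →+* MvPolynomial (Fin N) ℚ), coeff_C_mul, coeff_monomial, if_neg, mul_zero]
    rintro rfl
    apply hb; ext; simp
  · intro hh
    exfalso; apply hh; simp [Finset.mem_piAntidiag, h]

def cmE (L : ℕ) : Fin L × Fin 2 ≃ Fin (2 * L) := finProdFinEquiv.trans (finCongr (mul_comm _ _))

lemma cmE0 (L : ℕ) (l : Fin L) : cmE L (l, 0) = ⟨2 * l.val, by have := l.isLt; omega⟩ := by
  ext; simp [cmE]
lemma cmE1 (L : ℕ) (l : Fin L) : cmE L (l, 1) = ⟨2 * l.val + 1, by have := l.isLt; omega⟩ := by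
  ext; simp [cmE, add_comm]

def cmF (L N : ℕ) : (Fin (2 * L) → Fin N) ≃ (Fin L → Fin N × Fin N) where
  toFun Y l := (Y (cmE L (l, 0)), Y (cmE L (l, 1)))
  invFun Z t := if ((cmE L).symm t).2 = 0 then (Z ((cmE L).symm t).1).1 else (Z ((cmE L).symm t).1).2
  left_inv Y := by
    ext t
    obtain ⟨⟨l, b⟩, rfl⟩ := (cmE L).surjective t
    fin_cases b <;> simp
  right_inv Z := by
    ext l <;> simp

open MvPolynomial in
lemma cm_count (N L : ℕ) (k : Fin N →₀ ℕ) (Q : Finset (Fin N × Fin N)) :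
    ((Finset.univ.filter fun Y : Fin (2 * L) → Fin N =>
      (∀ v, (Finset.univ.filter fun t => Y t = v).card = k v) ∧ ∀ l, cmF L N Y l ∈ Q).card : ℚ)
     = coeff k ((∑ p ∈ Q, X p.1 * X p.2 : MvPolynomial (Fin N) ℚ) ^ L) := by
  have h1 : (∑ p ∈ Q, X p.1 * X p.2 : MvPolynomial (Fin N) ℚ) ^ L
      = ∑ Y : Fin (2 * L) → Fin N with ∀ l, cmF L N Y l ∈ Q, ∏ t, X (Y t) := by
    have := Finset.prod_univ_sum (fun _ : Fin L => Q)
      (fun _ p => (X p.1 * X p.2 : MvPolynomial (Fin N) ℚ))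
    rw [Finset.prod_const, Finset.card_univ, Fintype.card_fin] at this
    rw [this]
    symm
    refine Finset.sum_equiv (cmF L N) (by simp [Fintype.mem_piFinset]) ?_
    intro Y _
    rw [← (cmE L).prod_comp, Fintype.prod_prod_type]
    simp [Fin.prod_univ_two, cmF]
  have h2 : ∀ Y : Fin (2 * L) → Fin N, coeff k (∏ t, (X (Y t) : MvPolynomial (Fin N) ℚ)) =
      if (∀ v, (Finset.univ.filter fun t => Y t = v).card = k v) then 1 else 0 := by
    intro Y
    have : (∏ t, (X (Y t) : MvPolynomial (Fin N) ℚ)) = monomial (∑ t, Finsupp.single (Y t) 1) 1 := by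
      rw [monomial_sum_one]; rfl
    rw [this, coeff_monomial]
    congr 1
    rw [Finsupp.ext_iff, eq_iff_iff]
    refine forall_congr' fun v => ?_
    rw [Finsupp.finset_sum_apply, Finset.card_filter]
    simp [Finsupp.single_apply]
  rw [h1, coeff_sum, Finset.sum_congr rfl (fun Y _ => h2 Y), Finset.sum_boole, Finset.filter_filter]
  congr 3; ext; tauto

lemma cm_prod (N t : ℕ) (k : Fin N → ℕ) (i j : Fin N) (hij : i ≠ j) :
   (∏ v, ((k v - (if i = v then t else 0) - (if j = v then t else 0)).factorial : ℚ)) * ((k i).factorial * (k j).factorial)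
    = (∏ v, ((k v).factorial : ℚ)) * ((k i - t).factorial * (k j - t).factorial) := by
  have hj : j ∈ univ.erase i := by simp [hij.symm]
  rw [← Finset.mul_prod_erase _ _ (mem_univ i), ← Finset.mul_prod_erase _ _ hj,
   ← Finset.mul_prod_erase univ (fun v => ((k v).factorial : ℚ)) (mem_univ i), ← Finset.mul_prod_erase _ (fun v => ((k v).factorial : ℚ)) hj]
  have : ∏ v ∈ (univ.erase i).erase j, ((k v - (if i = v then t else 0) - (if j = v then t else 0)).factorial : ℚ)
    = ∏ v ∈ (univ.erase i).erase j, ((k v).factorial : ℚ) := by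
    apply Finset.prod_congr rfl
    intro v hv
    simp only [mem_erase, mem_univ, and_true] at hv
    simp [Ne.symm hv.1, Ne.symm hv.2]
  rw [this]
  simp [hij, hij.symm]
  ring

open MvPolynomial in
lemma cm_term (N L t : ℕ) (k : Fin N →₀ ℕ) (hsum : ∑ v, k v = 2 * L)
    (i j : Fin N) (hij : i ≠ j) (hkij : k i ≤ k j) :
    coeff k ((X i * X j) ^ t * (∑ v, X v : MvPolynomial (Fin N) ℚ) ^ (2 * L - 2 * t)) =
    if t ≤ k i then ((2 * L - 2 * t).factorial : ℚ) * ((k i).factorial * (k j).factorial) /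
      ((∏ v, ((k v).factorial : ℚ)) * ((k i - t).factorial * (k j - t).factorial)) else 0 := by
  have h1 : ((X i * X j) ^ t : MvPolynomial (Fin N) ℚ) =
      monomial (Finsupp.single i t + Finsupp.single j t) 1 := by
    rw [mul_pow, X_pow_eq_monomial, X_pow_eq_monomial, monomial_mul, one_mul]
  rw [h1, coeff_monomial_mul', one_mul]
  have h2 : (Finsupp.single i t + Finsupp.single j t ≤ k) ↔ t ≤ k i := by
    constructor
    · intro h
      have := h i
      simpa [Finsupp.single_apply, hij.symm] using this
    · intro h v
      by_cases h3 : i = v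
      · subst h3; simpa [Finsupp.single_apply, hij.symm] using h
      · by_cases h4 : j = v
        · subst h4; simp [Finsupp.single_apply, hij]; omega
        · simp [Finsupp.single_apply, h3, h4]
  simp only [h2]
  split_ifs with ht
  · have hle := h2.2 ht
    rw [cm_coeff, ← cm_prod N t k i j hij]
    · have : ∀ v, (k - (Finsupp.single i t + Finsupp.single j t)) v = k v - (if i = v then t else 0) - (if j = v then t else 0) := by
        intro v; simp [Finsupp.single_apply, Nat.sub_sub]
      simp only [this]
      have := (k i).factorial_ne_zero
      have := (k j).factorial_ne_zero
      rw [mul_div_mul_right]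
      positivity
    · have h5 : ∑ v, (k - (Finsupp.single i t + Finsupp.single j t)) v + ∑ v, (Finsupp.single i t + Finsupp.single j t) v = 2 * L := by
        rw [← hsum, ← Finset.sum_add_distrib]
        apply Finset.sum_congr rfl
        intro v _
        have := hle v
        simp only [Finsupp.tsub_apply]
        omega
      have h6 : ∑ v, (Finsupp.single i t + Finsupp.single j t) v = 2 * t := by
        simp [Finset.sum_add_distrib, Finsupp.single_apply]; ring
      omega
  · rfl

open MvPolynomial in
theorem configuration_model_link_probability
    (N L : ℕ) (hN : 2 ≤ N) (hL : 0 < L)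
    (k : Fin N → ℕ) (hsum : ∑ v, k v = 2 * L)
    (i j : Fin N) (hij : i ≠ j) (hki : 1 ≤ k i) (hkij : k i ≤ k j) :
    let S : Finset (Fin (2 * L) → Fin N) :=
      Finset.univ.filter fun Y =>
        ∀ v : Fin N, (Finset.univ.filter fun t => Y t = v).card = k v
    let A : Finset (Fin (2 * L) → Fin N) :=
      S.filter fun Y => ∃ l : Fin L,
        (Y ⟨2 * l.val, by have := l.isLt; omega⟩ = i ∧
          Y ⟨2 * l.val + 1, by have := l.isLt; omega⟩ = j) ∨
        (Y ⟨2 * l.val, by have := l.isLt; omega⟩ = j ∧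
          Y ⟨2 * l.val + 1, by have := l.isLt; omega⟩ = i)
    (A.card : ℚ) / (S.card : ℚ) =
      ((L.factorial * (k i).factorial * (k j).factorial : ℚ) / ((2 * L).factorial : ℚ)) *
        ∑ l ∈ Finset.Icc 1 (k i),
          (-1 : ℚ) ^ (l - 1) * 2 ^ l * ((2 * L - 2 * l).factorial : ℚ) /
            ((l.factorial : ℚ) * ((L - l).factorial : ℚ) *
              ((k i - l).factorial : ℚ) * ((k j - l).factorial : ℚ)) := by
  intro S A
  obtain ⟨K, rfl⟩ : ∃ K : Fin N →₀ ℕ, k = K := ⟨Finsupp.equivFunOnFinite.symm k, by ext; simp⟩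
  have hKL : K i ≤ L := by
    have : K i + K j ≤ 2 * L := by
      rw [← hsum, ← Finset.sum_pair hij]
      exact Finset.sum_le_sum_of_subset (subset_univ _)
    omega
  have hP : (∏ v, ((K v).factorial : ℚ)) ≠ 0 := by
    apply Finset.prod_ne_zero_iff.2; intro v _; positivity
  set P : MvPolynomial (Fin N) ℚ := ∑ v, X v with hPdef
  have hS : (S.card : ℚ) = ((2 * L).factorial : ℚ) / ∏ v, ((K v).factorial : ℚ) := by
    rw [← cm_coeff _ K hsum, pow_mul]
    have := cm_count N L K univ
    simp only [mem_univ, implies_true, and_true] at this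
    rw [this, sq, Finset.sum_mul_sum, ← Finset.sum_product', univ_product_univ]
  let Q : Finset (Fin N × Fin N) := univ \ {(i, j), (j, i)}
  have hQ : (∑ p ∈ Q, X p.1 * X p.2 : MvPolynomial (Fin N) ℚ) = (-2 : ℚ) • (X i * X j) + P ^ 2 := by
    have h := Finset.sum_sdiff (f := fun p : Fin N × Fin N => (X p.1 * X p.2 : MvPolynomial (Fin N) ℚ)) (subset_univ {(i, j), (j, i)})
    rw [Finset.sum_pair (by simp [hij])] at h
    rw [hPdef, sq, Finset.sum_mul_sum, ← Finset.sum_product', univ_product_univ, ← h, neg_smul, two_smul]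
    ring
  have hA : (A.card : ℚ) = S.card - coeff K (((-2 : ℚ) • (X i * X j) + P ^ 2) ^ L) := by
    rw [← hQ, ← cm_count, eq_sub_iff_add_eq, ← Finset.card_filter_add_card_filter_not (s := S) (fun Y => ∃ l : Fin L,
        (Y ⟨2 * l.val, by have := l.isLt; omega⟩ = i ∧
          Y ⟨2 * l.val + 1, by have := l.isLt; omega⟩ = j) ∨
        (Y ⟨2 * l.val, by have := l.isLt; omega⟩ = j ∧
          Y ⟨2 * l.val + 1, by have := l.isLt; omega⟩ = i))]
    push_cast
    congr 3
    ext Y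
    simp [S, Q, cmF, cmE0, cmE1]
  have hexp : coeff K (((-2 : ℚ) • (X i * X j) + P ^ 2) ^ L) = ∑ t ∈ range (L + 1),
      (-2 : ℚ) ^ t * (L.choose t) * if t ≤ K i then ((2 * L - 2 * t).factorial : ℚ) * ((K i).factorial * (K j).factorial) /
      ((∏ v, ((K v).factorial : ℚ)) * ((K i - t).factorial * (K j - t).factorial)) else 0 := by
    rw [add_pow, coeff_sum]
    apply Finset.sum_congr rfl
    intro t _
    rw [← cm_term N L t K hsum i j hij hkij, ← hPdef, ← pow_mul, Nat.mul_sub, smul_pow, smul_mul_assoc, smul_mul_assoc, coeff_smul, ← map_natCast (C : ℚ →+* MvPolynomial (Fin N) ℚ), mul_comm _ (C _), coeff_C_mul, smul_eq_mul, mul_assoc]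
  have hsplit : ∀ f : ℕ → ℚ, (∑ t ∈ range (L + 1), if t ≤ K i then f t else 0) = f 0 + ∑ t ∈ Icc 1 (K i), f t := by
    intro f
    rw [← Finset.sum_filter]
    have : (range (L + 1)).filter (fun t => t ≤ K i) = insert 0 (Icc 1 (K i)) := by
      ext t; simp; omega
    rw [this, Finset.sum_insert (by simp)]
  simp only [mul_ite, mul_zero] at hexp
  rw [hsplit] at hexp
  rw [hA, hexp, hS]
  have hf : ((2 * L).factorial : ℚ) ≠ 0 := by positivity
  have hi : ((K i).factorial : ℚ) ≠ 0 := by positivity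
  have hj : ((K j).factorial : ℚ) ≠ 0 := by positivity
  have h0 : (-2 : ℚ) ^ 0 * (L.choose 0) * (((2 * L - 2 * 0).factorial : ℚ) * ((K i).factorial * (K j).factorial) /
      ((∏ v, ((K v).factorial : ℚ)) * ((K i - 0).factorial * (K j - 0).factorial))) = ((2 * L).factorial : ℚ) / ∏ v, ((K v).factorial : ℚ) := by
    simp; field_simp
  rw [h0, sub_add_cancel_left, ← Finset.sum_neg_distrib, Finset.sum_div, Finset.mul_sum]
  apply Finset.sum_congr rfl
  intro t ht
  rw [mem_Icc] at ht
  rw [Nat.cast_choose ℚ (ht.2.trans hKL)]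
  obtain ⟨s, rfl⟩ : ∃ s, t = s + 1 := ⟨t - 1, by omega⟩
  rw [neg_pow 2, Nat.add_sub_cancel, pow_succ (-1 : ℚ)]
  field_simp
end
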